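/- Tripartite mutual-entropy identity (eq. (3.32)): the block-diagonal matrix D_1 := diag_{A×Ω}( p(α,ω)·ρ_f^α(ω) ) (with zero block when p(α,ω) = 0) and the matrix D_2 := diag_{A×Ω}( p_α·P_f(ω)·η_f ) are density matrices on ℂ^m ⊗ ℂ^{A×Ω} with ker D_2 ⊆ ker D_1, and S(D_1|D_2) = I_c + χ{p(·,·), ρ_f^•}, where χ{p(·,·), ρ_f^•} := Σ_{(α,ω) : p(α,ω) > 0} p(α,ω)·S(ρ_f^α(ω)|η_f). -/

import Mathlib

open Matrix BigOperators
open scoped Kronecker ComplexOrder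

noncomputable section

/-- A density matrix: positive semidefinite with unit trace. -/
def IsDensityMatrix {ι : Type*} [Fintype ι] (ρ : Matrix ι ι ℂ) : Prop :=
  ρ.PosSemidef ∧ ρ.trace = 1

/-- von Neumann entropy (natural logarithm), via the eigenvalues;
junk value `0` if the matrix is not Hermitian. -/
noncomputable def vnEntropy {ι : Type*} [Fintype ι] [DecidableEq ι]
    (ρ : Matrix ι ι ℂ) : ℝ :=
  if h : ρ.IsHermitian then -∑ i, h.eigenvalues i * Real.log (h.eigenvalues i) else 0

/-- Quantum relative entropy `S(σ|τ)` (natural logarithm), computed in an orthonormal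
eigenbasis of `τ`; junk value `0` if `σ` or `τ` is not Hermitian. -/
noncomputable def relEnt {ι : Type*} [Fintype ι] [DecidableEq ι]
    (σ τ : Matrix ι ι ℂ) : ℝ :=
  if h : σ.IsHermitian ∧ τ.IsHermitian then
    (∑ i, h.1.eigenvalues i * Real.log (h.1.eigenvalues i))
      - ∑ j, (if 0 < h.2.eigenvalues j then
          Real.log (h.2.eigenvalues j) *
            ((star (fun i => h.2.eigenvectorBasis j i)) ⬝ᵥ
              σ.mulVec (fun i => h.2.eigenvectorBasis j i)).re
        else 0)
  else 0

/-- Holevo χ-quantity of an ensemble of states, relative to its barycenter. -/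
noncomputable def holevoChi {ι B : Type*} [Fintype ι] [DecidableEq ι] [Fintype B]
    (q : B → ℝ) (τ : B → Matrix ι ι ℂ) : ℝ :=
  ∑ β, if 0 < q β then q β * relEnt (τ β) (∑ γ, q γ • τ γ) else 0

/-- The action of an instrument in Kraus form: `I_ω(ρ) = ∑ k, V ω k * ρ * (V ω k)ᴴ`. -/
noncomputable def instAct {n m : ℕ} {Ω K : Type*} [Fintype K]
    (V : Ω → K → Matrix (Fin m) (Fin n) ℂ) (ω : Ω)
    (ρ : Matrix (Fin n) (Fin n) ℂ) : Matrix (Fin m) (Fin m) ℂ :=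
  ∑ k, V ω k * ρ * (V ω k)ᴴ

/-- The POVM associated with an instrument in Kraus form: `E_ω = ∑ k, (V ω k)ᴴ * V ω k`. -/
noncomputable def povm {n m : ℕ} {Ω K : Type*} [Fintype K]
    (V : Ω → K → Matrix (Fin m) (Fin n) ℂ) (ω : Ω) : Matrix (Fin n) (Fin n) ℂ :=
  ∑ k, (V ω k)ᴴ * V ω k

/-- Outcome probability `Tr(E_ω ρ)`. -/
noncomputable def probOut {n m : ℕ} {Ω K : Type*} [Fintype K]
    (V : Ω → K → Matrix (Fin m) (Fin n) ℂ) (ρ : Matrix (Fin n) (Fin n) ℂ) (ω : Ω) : ℝ :=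
  ((povm V ω * ρ).trace).re

/-- The a posteriori state `π_ρ(ω) = I_ω(ρ)/Tr(I_ω(ρ))` (junk if the trace vanishes). -/
noncomputable def post {n m : ℕ} {Ω K : Type*} [Fintype K]
    (V : Ω → K → Matrix (Fin m) (Fin n) ℂ) (ω : Ω)
    (ρ : Matrix (Fin n) (Fin n) ℂ) : Matrix (Fin m) (Fin m) ℂ :=
  (((instAct V ω ρ).trace.re)⁻¹ : ℝ) • instAct V ω ρ

/-- The classical (Shannon) input/output mutual information of the ensemble `(p, ρ)`
measured with the POVM of the instrument `V`. -/
noncomputable def Ic {n m : ℕ} {A Ω K : Type*} [Fintype A] [Fintype Ω] [Fintype K]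
    (p : A → ℝ) (ρ : A → Matrix (Fin n) (Fin n) ℂ)
    (V : Ω → K → Matrix (Fin m) (Fin n) ℂ) : ℝ :=
  ∑ α, ∑ ω,
    if 0 < p α * probOut V (ρ α) ω then
      p α * probOut V (ρ α) ω *
        Real.log ((p α * probOut V (ρ α) ω) /
          (p α * probOut V (∑ β, p β • ρ β) ω))
    else 0

/-- Quantum information gain of the instrument `V` at the state `ρ`. -/
noncomputable def infoGain {n m : ℕ} {Ω K : Type*} [Fintype Ω] [Fintype K]
    (V : Ω → K → Matrix (Fin m) (Fin n) ℂ) (ρ : Matrix (Fin n) (Fin n) ℂ) : ℝ :=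
  vnEntropy ρ - ∑ ω, if 0 < (instAct V ω ρ).trace.re then
    (instAct V ω ρ).trace.re * vnEntropy (post V ω ρ) else 0


/-- Block-diagonal matrix `∑ x, B x ⊗ |x⟩⟨x|` on `ℂ^d ⊗ ℂ^X`. -/
noncomputable def blockDiag {d : ℕ} {X : Type*} [DecidableEq X]
    (B : X → Matrix (Fin d) (Fin d) ℂ) : Matrix (Fin d × X) (Fin d × X) ℂ :=
  fun p q => if p.2 = q.2 then B p.2 p.1 q.1 else 0

namespace Matrix

section Spectral

variable {ι : Type*} [Fintype ι] [DecidableEq ι]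

theorem continuousOn_spectrum (f : ℝ → ℝ) (τ : Matrix ι ι ℂ) :
    ContinuousOn f (spectrum ℝ τ) :=
  (finite_real_spectrum (A := τ)).continuousOn f

theorem IsHermitian.trace_cfc_mul {τ : Matrix ι ι ℂ} (hτ : τ.IsHermitian) (f : ℝ → ℝ)
    (σ : Matrix ι ι ℂ) :
    (cfc f τ * σ).trace = ∑ j, (f (hτ.eigenvalues j) : ℂ) *
      (star (fun i => hτ.eigenvectorBasis j i) ⬝ᵥ
        σ.mulVec (fun i => hτ.eigenvectorBasis j i)) := by
  rw [hτ.cfc_eq, IsHermitian.cfc, Unitary.conjStarAlgAut_apply, Matrix.mul_assoc,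
    Matrix.mul_assoc, Matrix.trace_mul_comm, Matrix.mul_assoc, Matrix.trace]
  refine Finset.sum_congr rfl fun j _ => ?_
  rw [diag_apply, diagonal_mul, Matrix.mul_assoc, Matrix.mul_apply]
  rfl

theorem IsHermitian.trace_cfc {τ : Matrix ι ι ℂ} (hτ : τ.IsHermitian) (f : ℝ → ℝ) :
    (cfc f τ).trace = ∑ j, (f (hτ.eigenvalues j) : ℂ) := by
  rw [hτ.cfc_eq, IsHermitian.cfc, Unitary.conjStarAlgAut_apply, Matrix.trace_mul_comm,
    ← Matrix.mul_assoc, Unitary.coe_star_mul_self, Matrix.one_mul, trace_diagonal]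
  rfl

theorem cfc_log_smul {τ : Matrix ι ι ℂ} (hτ : τ.IsHermitian) {c : ℝ} (hc : c ≠ 0) :
    cfc Real.log (c • τ) =
      cfc Real.log τ + Real.log c • cfc (fun x : ℝ => if x = 0 then 0 else 1) τ := by
  have ha : IsSelfAdjoint τ := hτ
  rw [← cfc_comp_smul c Real.log τ
      ((finite_real_spectrum (A := τ)).image _ |>.continuousOn _) ha,
    ← cfc_const_mul _ _ τ (continuousOn_spectrum _ τ),
    ← cfc_add τ _ _ (continuousOn_spectrum _ τ) (continuousOn_spectrum _ τ)]
  congr 1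
  funext x
  by_cases hx : x = 0
  · simp [hx]
  · simp [hx, Real.log_mul hc hx, add_comm]

theorem cfc_mul_log_smul {τ : Matrix ι ι ℂ} (hτ : τ.IsHermitian) {c : ℝ} (hc : c ≠ 0) :
    cfc (fun x : ℝ => x * Real.log x) (c • τ) =
      c • cfc (fun x : ℝ => x * Real.log x) τ + (c * Real.log c) • τ := by
  have ha : IsSelfAdjoint τ := hτ
  have hid := cfc_const_mul_id (c * Real.log c) τ ha
  rw [← cfc_comp_smul c (fun x : ℝ => x * Real.log x) τ
      ((finite_real_spectrum (A := τ)).image _ |>.continuousOn _) ha, ← hid,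
    ← cfc_const_mul _ _ τ (continuousOn_spectrum _ τ),
    ← cfc_add τ _ _ (continuousOn_spectrum _ τ) (continuousOn_spectrum _ τ)]
  congr 1
  funext x
  by_cases hx : x = 0
  · simp [hx]
  · simp only [smul_eq_mul, Real.log_mul hc hx]
    ring

/-- The support projection of `τ` fixes any matrix whose kernel contains that of `τ`. -/
theorem mul_cfc_support {τ σ : Matrix ι ι ℂ} (hτ : τ.IsHermitian)
    (hker : ∀ v, τ *ᵥ v = 0 → σ *ᵥ v = 0) :
    σ * cfc (fun x : ℝ => if x = 0 then 0 else 1) τ = σ := by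
  have ha : IsSelfAdjoint τ := hτ
  set s := cfc (fun x : ℝ => if x = 0 then (0 : ℝ) else 1) τ with hs
  have h1 : τ * s = τ := by
    conv_lhs => rw [← cfc_id' ℝ τ ha]
    conv_rhs => rw [← cfc_id' ℝ τ ha]
    rw [hs, ← cfc_mul _ _ τ (continuousOn_spectrum _ τ) (continuousOn_spectrum _ τ)]
    congr 1
    funext x
    by_cases hx : x = 0 <;> simp [hx]
  have h2 : σ * (1 - s) = 0 := by
    ext i j
    have h3 : τ *ᵥ (fun k => (1 - s) k j) = 0 := by
      have h4 : τ * (1 - s) = 0 := by rw [Matrix.mul_sub, h1, Matrix.mul_one, sub_self]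
      funext k
      exact congrFun (congrFun h4 k) j
    exact congrFun (hker _ h3) i
  rw [Matrix.mul_sub, Matrix.mul_one, sub_eq_zero] at h2
  exact h2.symm

end Spectral

section Block

variable {ι X : Type*} [Fintype ι] [Fintype X] [DecidableEq X]

theorem blockDiagonal_mulVec_apply (B : X → Matrix ι ι ℂ) (v : ι × X → ℂ) (i : ι) (x : X) :
    (blockDiagonal B *ᵥ v) (i, x) = (B x *ᵥ fun j => v (j, x)) i := by
  simp only [mulVec, dotProduct, blockDiagonal_apply, Fintype.sum_prod_type, ite_mul, zero_mul,
    Finset.sum_ite_eq, Finset.mem_univ, if_true]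

theorem PosSemidef.blockDiagonal {B : X → Matrix ι ι ℂ} (hB : ∀ x, (B x).PosSemidef) :
    (blockDiagonal B).PosSemidef := by
  refine PosSemidef.of_dotProduct_mulVec_nonneg
    (isHermitian_blockDiagonal_iff.2 fun x => (hB x).isHermitian) fun v => ?_
  rw [dotProduct, Fintype.sum_prod_type_right]
  refine Finset.sum_nonneg fun x _ => ?_
  simp only [blockDiagonal_mulVec_apply]
  exact (hB x).dotProduct_mulVec_nonneg fun j => v (j, x)

theorem cfc_blockDiagonal [DecidableEq ι] {B : X → Matrix ι ι ℂ} (hB : ∀ x, (B x).IsHermitian) (f : ℝ → ℝ) :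
    cfc f (blockDiagonal B) = blockDiagonal fun x => cfc f (B x) := by
  let φ : (X → Matrix ι ι ℂ) →ₐ[ℝ] Matrix (ι × X) (ι × X) ℂ :=
    { blockDiagonalRingHom ι X ℂ with
      commutes' := fun r => by
        ext ⟨i, x⟩ ⟨j, y⟩
        by_cases h : x = y <;> by_cases h' : i = j <;>
          simp [blockDiagonal_apply, algebraMap_matrix_apply, h, h'] }
  have hfin : (spectrum ℝ (blockDiagonal B) ∪ ⋃ x, spectrum ℝ (B x)).Finite :=
    finite_real_spectrum.union (Set.finite_iUnion fun x => finite_real_spectrum)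
  let q := Lagrange.interpolate hfin.toFinset id f
  have hq : ∀ x ∈ hfin.toFinset, f x = q.eval x := fun x hx =>
    (Lagrange.eval_interpolate_at_node f (Function.injective_id.injOn) hx).symm
  have h1 : cfc f (blockDiagonal B) = Polynomial.aeval (blockDiagonal B) q := by
    rw [← cfc_polynomial q _ (isHermitian_blockDiagonal_iff.2 hB)]
    exact cfc_congr fun x hx => hq x (hfin.mem_toFinset.2 (Or.inl hx))
  have h2 : ∀ x, cfc f (B x) = Polynomial.aeval (B x) q := fun x => by
    rw [← cfc_polynomial q _ (hB x)]
    exact cfc_congr fun y hy => hq y (hfin.mem_toFinset.2 (Or.inr (Set.mem_iUnion.2 ⟨x, hy⟩)))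
  have h3 : Polynomial.aeval (φ B) q = φ (Polynomial.aeval B q) :=
    Polynomial.aeval_algHom_apply φ B q
  rw [h1]
  refine h3.trans ?_
  change blockDiagonal (Polynomial.aeval B q) = _
  congr 1
  funext x
  rw [h2]
  exact (Polynomial.aeval_algHom_apply (Pi.evalAlgHom ℝ (fun _ => Matrix ι ι ℂ) x) B q).symm

end Block

theorem PosSemidef.mulVec_eq_zero_of_sum {ι β : Type*} [Fintype ι] [Fintype β]
    {B : β → Matrix ι ι ℂ} (hB : ∀ b, (B b).PosSemidef) {v : ι → ℂ}
    (hv : (∑ b, B b) *ᵥ v = 0) (b : β) : B b *ᵥ v = 0 := by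
  classical
  have h0 : ∑ b, star v ⬝ᵥ (B b *ᵥ v) = 0 := by
    rw [← dotProduct_sum, ← sum_mulVec, hv, dotProduct_zero]
  rw [Finset.sum_eq_zero_iff_of_nonneg fun b _ => (hB b).dotProduct_mulVec_nonneg v] at h0
  exact ((hB b).dotProduct_mulVec_zero_iff v).1 (h0 b (Finset.mem_univ b))

end Matrix

theorem blockDiag_eq_blockDiagonal {d : ℕ} {X : Type*} [DecidableEq X]
    (B : X → Matrix (Fin d) (Fin d) ℂ) : _root_.blockDiag B = blockDiagonal B := by
  ext p q
  rw [_root_.blockDiag, blockDiagonal_apply]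

/-- Relative entropy as a difference of traces in the functional calculus. -/
theorem relEnt_eq_trace {ι : Type*} [Fintype ι] [DecidableEq ι] {σ τ : Matrix ι ι ℂ}
    (hσ : σ.IsHermitian) (hτ : τ.PosSemidef) :
    relEnt σ τ = (cfc (fun x : ℝ => x * Real.log x) σ).trace.re
      - (cfc Real.log τ * σ).trace.re := by
  rw [relEnt, dif_pos ⟨hσ, hτ.isHermitian⟩, hσ.trace_cfc, hτ.isHermitian.trace_cfc_mul,
    Complex.re_sum, Complex.re_sum]
  congr 1
  refine Finset.sum_congr rfl fun j _ => ?_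
  rw [Complex.re_ofReal_mul]
  split_ifs with h
  · rfl
  · rw [le_antisymm (not_lt.1 h) (hτ.eigenvalues_nonneg j), Real.log_zero, zero_mul]

theorem relEnt_blockDiagonal {ι X : Type*} [Fintype ι] [DecidableEq ι] [Fintype X]
    [DecidableEq X] {σ τ : X → Matrix ι ι ℂ} (hσ : ∀ x, (σ x).IsHermitian)
    (hτ : ∀ x, (τ x).PosSemidef) :
    relEnt (blockDiagonal σ) (blockDiagonal τ) = ∑ x, relEnt (σ x) (τ x) := by
  rw [relEnt_eq_trace (isHermitian_blockDiagonal_iff.2 hσ) (PosSemidef.blockDiagonal hτ),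
    cfc_blockDiagonal hσ, cfc_blockDiagonal fun x => (hτ x).isHermitian,
    ← blockDiagonal_mul, trace_blockDiagonal, trace_blockDiagonal, Complex.re_sum,
    Complex.re_sum, ← Finset.sum_sub_distrib]
  exact Finset.sum_congr rfl fun x _ => (relEnt_eq_trace (hσ x) (hτ x)).symm

theorem relEnt_zero_left {ι : Type*} [Fintype ι] [DecidableEq ι] {τ : Matrix ι ι ℂ}
    (hτ : τ.PosSemidef) : relEnt 0 τ = 0 := by
  rw [relEnt_eq_trace isHermitian_zero hτ, cfc_apply_zero]
  simp

theorem relEnt_smul_smul {ι : Type*} [Fintype ι] [DecidableEq ι] {σ τ : Matrix ι ι ℂ}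
    (hσ : σ.IsHermitian) (hσ1 : σ.trace = 1) (hτ : τ.PosSemidef)
    (hker : ∀ v, τ *ᵥ v = 0 → σ *ᵥ v = 0) {c d : ℝ} (hc : 0 < c) (hd : 0 < d) :
    relEnt (c • σ) (d • τ) = c * Real.log (c / d) + c * relEnt σ τ := by
  have hcσ : (c • σ).IsHermitian := IsSelfAdjoint.smul (star_trivial c) hσ
  have htr : (cfc (fun x : ℝ => if x = 0 then 0 else 1) τ * σ).trace = 1 := by
    rw [trace_mul_comm, mul_cfc_support hτ.isHermitian hker, hσ1]
  rw [relEnt_eq_trace hcσ (hτ.smul hd.le), relEnt_eq_trace hσ hτ,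
    cfc_mul_log_smul hσ hc.ne', cfc_log_smul hτ.isHermitian hd.ne', Real.log_div hc.ne' hd.ne']
  simp only [Matrix.add_mul, Matrix.mul_smul, Matrix.smul_mul, trace_add, trace_smul, htr, hσ1,
    Complex.add_re, Complex.smul_re, smul_eq_mul, Complex.one_re]
  ring

section Instrument

variable {n m : ℕ} {Ω K : Type*} [Fintype K] (V : Ω → K → Matrix (Fin m) (Fin n) ℂ)

theorem instAct_posSemidef (ω : Ω) {ρ : Matrix (Fin n) (Fin n) ℂ} (hρ : ρ.PosSemidef) :
    (instAct V ω ρ).PosSemidef :=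
  posSemidef_sum _ fun k _ => hρ.mul_mul_conjTranspose_same (V ω k)

theorem trace_instAct (ω : Ω) (ρ : Matrix (Fin n) (Fin n) ℂ) :
    (instAct V ω ρ).trace = (povm V ω * ρ).trace := by
  rw [instAct, povm, Matrix.sum_mul, trace_sum, trace_sum]
  refine Finset.sum_congr rfl fun k _ => ?_
  rw [trace_mul_comm, Matrix.mul_assoc]

theorem trace_instAct_eq_probOut (ω : Ω) {ρ : Matrix (Fin n) (Fin n) ℂ} (hρ : ρ.PosSemidef) :
    (instAct V ω ρ).trace = probOut V ρ ω := by
  rw [probOut, ← trace_instAct]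
  refine Complex.ext rfl ?_
  rw [Complex.ofReal_im]
  exact (Complex.nonneg_iff.1 (instAct_posSemidef V ω hρ).trace_nonneg).2.symm

theorem probOut_nonneg (ω : Ω) {ρ : Matrix (Fin n) (Fin n) ℂ} (hρ : ρ.PosSemidef) :
    0 ≤ probOut V ρ ω := by
  rw [← Complex.zero_le_real, ← trace_instAct_eq_probOut V ω hρ]
  exact (instAct_posSemidef V ω hρ).trace_nonneg

theorem instAct_sum_smul {A : Type*} [Fintype A] (ω : Ω) (p : A → ℝ)
    (ρ : A → Matrix (Fin n) (Fin n) ℂ) :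
    instAct V ω (∑ α, p α • ρ α) = ∑ α, p α • instAct V ω (ρ α) := by
  simp only [instAct, Matrix.mul_sum, Matrix.sum_mul, Finset.smul_sum, Matrix.mul_smul,
    Matrix.smul_mul]
  exact Finset.sum_comm

theorem probOut_sum_smul {A : Type*} [Fintype A] (ω : Ω) (p : A → ℝ)
    (ρ : A → Matrix (Fin n) (Fin n) ℂ) :
    probOut V (∑ α, p α • ρ α) ω = ∑ α, p α * probOut V (ρ α) ω := by
  simp only [probOut, Matrix.mul_sum, Matrix.mul_smul, trace_sum, trace_smul, Complex.re_sum,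
    Complex.smul_re, smul_eq_mul]

theorem post_eq (ω : Ω) (ρ : Matrix (Fin n) (Fin n) ℂ) :
    post V ω ρ = (probOut V ρ ω)⁻¹ • instAct V ω ρ := by
  rw [post, probOut, trace_instAct]

theorem post_isDensityMatrix (ω : Ω) {ρ : Matrix (Fin n) (Fin n) ℂ} (hρ : ρ.PosSemidef)
    (h : 0 < probOut V ρ ω) : IsDensityMatrix (post V ω ρ) := by
  rw [post_eq]
  refine ⟨(instAct_posSemidef V ω hρ).smul (inv_nonneg.2 h.le), ?_⟩
  rw [trace_smul, trace_instAct_eq_probOut V ω hρ, Complex.real_smul, ← Complex.ofReal_mul,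
    inv_mul_cancel₀ h.ne', Complex.ofReal_one]

theorem sum_probOut [Fintype Ω] (hV : ∑ ω, ∑ k, (V ω k)ᴴ * V ω k = 1)
    {ρ : Matrix (Fin n) (Fin n) ℂ} (hρ : ρ.trace = 1) : ∑ ω, probOut V ρ ω = 1 := by
  simp only [probOut]
  rw [← Complex.re_sum, ← trace_sum, ← Matrix.sum_mul]
  simp only [povm]
  rw [hV, Matrix.one_mul, hρ, Complex.one_re]

end Instrument

theorem tripartite_mutual_entropy_identity {A Ω K : Type*} [Fintype A] [Fintype Ω] [Fintype K]
    [Nonempty A] [Nonempty Ω] [Nonempty K] {n m : ℕ} (hn : 1 ≤ n) (hm : 1 ≤ m)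
    (p : A → ℝ) (hp0 : ∀ α, 0 ≤ p α) (hp1 : ∑ α, p α = 1)
    (ρ : A → Matrix (Fin n) (Fin n) ℂ) (hρ : ∀ α, IsDensityMatrix (ρ α))
    (V : Ω → K → Matrix (Fin m) (Fin n) ℂ)
    (hV : ∑ ω, ∑ k, (V ω k)ᴴ * V ω k = 1)
    (η : Matrix (Fin n) (Fin n) ℂ) (hη : η = ∑ α, p α • ρ α)
    (Pf : Ω → ℝ) (hPf : ∀ ω, Pf ω = probOut V η ω)
    (ηf : Matrix (Fin m) (Fin m) ℂ) (hηf : ηf = ∑ ω, instAct V ω η)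
    [DecidableEq A] [DecidableEq Ω]
    (D1 D2 : Matrix (Fin m × (A × Ω)) (Fin m × (A × Ω)) ℂ)
    (hD1 : D1 = blockDiag (fun x : A × Ω =>
      if 0 < p x.1 * probOut V (ρ x.1) x.2 then
        (p x.1 * probOut V (ρ x.1) x.2) • post V x.2 (ρ x.1) else 0))
    (hD2 : D2 = blockDiag (fun x : A × Ω => (p x.1 * Pf x.2) • ηf)) :
    IsDensityMatrix D1 ∧ IsDensityMatrix D2 ∧
    (∀ v : Fin m × (A × Ω) → ℂ, D2.mulVec v = 0 → D1.mulVec v = 0) ∧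
    relEnt D1 D2 =
      Ic p ρ V + ∑ α, ∑ ω, (if 0 < p α * probOut V (ρ α) ω then
        (p α * probOut V (ρ α) ω) * relEnt (post V ω (ρ α)) ηf
      else 0) := by
  have hη1 : IsDensityMatrix η := by
    refine ⟨hη ▸ posSemidef_sum _ fun α _ => (hρ α).1.smul (hp0 α), ?_⟩
    simp only [hη, trace_sum, trace_smul, (hρ _).2, Complex.real_smul, mul_one]
    rw [← Complex.ofReal_sum, hp1, Complex.ofReal_one]
  have hηf1 : IsDensityMatrix ηf := by
    refine ⟨hηf ▸ posSemidef_sum _ fun ω _ => instAct_posSemidef V ω hη1.1, ?_⟩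
    rw [hηf, trace_sum]
    simp only [trace_instAct_eq_probOut V _ hη1.1]
    rw [← Complex.ofReal_sum, sum_probOut V hV hη1.2, Complex.ofReal_one]
  have hP0 : ∀ α ω, 0 ≤ probOut V (ρ α) ω := fun α ω => probOut_nonneg V ω (hρ α).1
  have hPf0 : ∀ ω, 0 ≤ Pf ω := fun ω => hPf ω ▸ probOut_nonneg V ω hη1.1
  have hPf1 : ∑ ω, Pf ω = 1 := by
    simp only [hPf]
    exact sum_probOut V hV hη1.2
  have hle : ∀ α ω, p α * probOut V (ρ α) ω ≤ Pf ω := fun α ω => by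
    rw [hPf, hη, probOut_sum_smul]
    exact Finset.single_le_sum (f := fun α => p α * probOut V (ρ α) ω)
      (fun β _ => mul_nonneg (hp0 β) (hP0 β ω)) (Finset.mem_univ α)
  have hpos : ∀ {α ω}, 0 < p α * probOut V (ρ α) ω → 0 < p α ∧ 0 < probOut V (ρ α) ω :=
    fun {α ω} h => ⟨pos_of_mul_pos_left h (hP0 α ω), pos_of_mul_pos_right h (hp0 α)⟩
  have hker : ∀ α ω, 0 < p α * probOut V (ρ α) ω → ∀ v, ηf *ᵥ v = 0 →
      post V ω (ρ α) *ᵥ v = 0 := fun α ω h v hv => by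
    rw [hηf] at hv
    have h1 := PosSemidef.mulVec_eq_zero_of_sum
      (fun ω => instAct_posSemidef V ω hη1.1) hv ω
    rw [hη, instAct_sum_smul] at h1
    have h2 := PosSemidef.mulVec_eq_zero_of_sum
      (fun β => (instAct_posSemidef V ω (hρ β).1).smul (hp0 β)) h1 α
    rw [smul_mulVec, smul_eq_zero_iff_right (hpos h).1.ne'] at h2
    rw [post_eq, smul_mulVec, h2, smul_zero]
  have hB1 : ∀ x : A × Ω, (if 0 < p x.1 * probOut V (ρ x.1) x.2 then
      (p x.1 * probOut V (ρ x.1) x.2) • post V x.2 (ρ x.1) else 0).PosSemidef := fun x => by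
    split_ifs with h
    · exact (post_isDensityMatrix V x.2 (hρ x.1).1 (hpos h).2).1.smul h.le
    · exact PosSemidef.zero
  have hB2 : ∀ x : A × Ω, ((p x.1 * Pf x.2) • ηf).PosSemidef := fun x =>
    hηf1.1.smul (mul_nonneg (hp0 _) (hPf0 _))
  rw [blockDiag_eq_blockDiagonal] at hD1 hD2
  subst hD1 hD2
  refine ⟨⟨PosSemidef.blockDiagonal hB1, ?_⟩, ⟨PosSemidef.blockDiagonal hB2, ?_⟩, ?_, ?_⟩
  · have htr : ∀ x : A × Ω, (if 0 < p x.1 * probOut V (ρ x.1) x.2 then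
        (p x.1 * probOut V (ρ x.1) x.2) • post V x.2 (ρ x.1) else 0).trace =
        ((p x.1 * probOut V (ρ x.1) x.2 : ℝ) : ℂ) := fun x => by
      split_ifs with h
      · rw [trace_smul, (post_isDensityMatrix V x.2 (hρ x.1).1 (hpos h).2).2, Complex.real_smul,
          mul_one]
      · rw [trace_zero, le_antisymm (not_lt.1 h) (mul_nonneg (hp0 _) (hP0 _ _)),
          Complex.ofReal_zero]
    rw [trace_blockDiagonal, Finset.sum_congr rfl fun x _ => htr x, ← Complex.ofReal_sum,
      Fintype.sum_prod_type]
    simp only [← Finset.mul_sum, sum_probOut V hV (hρ _).2, mul_one, hp1, Complex.ofReal_one]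
  · simp only [trace_blockDiagonal, trace_smul, hηf1.2, Complex.real_smul, mul_one]
    rw [← Complex.ofReal_sum, Fintype.sum_prod_type]
    simp only [← Finset.mul_sum, hPf1, mul_one, hp1, Complex.ofReal_one]
  · intro v hv
    funext ⟨i, x⟩
    rw [blockDiagonal_mulVec_apply]
    split_ifs with h
    · have hx : ((p x.1 * Pf x.2) • ηf) *ᵥ (fun j => v (j, x)) = 0 := funext fun i => by
        rw [← blockDiagonal_mulVec_apply (fun x : A × Ω => (p x.1 * Pf x.2) • ηf), hv]
        rfl
      rw [smul_mulVec, smul_eq_zero_iff_right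
        (mul_pos (hpos h).1 (h.trans_le (hle _ _))).ne'] at hx
      rw [smul_mulVec, hker _ _ h _ hx, smul_zero]
      rfl
    · rw [zero_mulVec]
      rfl
  · rw [relEnt_blockDiagonal (fun x => (hB1 x).isHermitian) hB2, Fintype.sum_prod_type, Ic,
      ← Finset.sum_add_distrib]
    refine Finset.sum_congr rfl fun α _ => ?_
    rw [← Finset.sum_add_distrib]
    refine Finset.sum_congr rfl fun ω _ => ?_
    rw [← hη, ← hPf]
    split_ifs with h
    · have hpost := post_isDensityMatrix V ω (hρ α).1 (hpos h).2
      exact relEnt_smul_smul hpost.1.isHermitian hpost.2 hηf1.1 (hker α ω h) h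
        (mul_pos (hpos h).1 (h.trans_le (hle α ω)))
    · rw [relEnt_zero_left (hB2 (α, ω)), add_zero]

end
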